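/- arXiv:2106.02955 — 2 statements merged into one kernel-verified Lean document; each statement's English description precedes it below -/
import Mathlib

section
/- Let T = K[z_1,…,z_s] be a polynomial ring over a field K with graded maximal ideal 𝔪 = ⟨z_1,…,z_s⟩, and for each positive integer N define J_N = ⋂_{c=c_0}^{h} ⋂_{S ⊆ {1,…,s}, |S| = c} ⟨z_i : i ∈ S⟩^{N·μ̂_c} (this ideal is the N-th symbolic power of the uniform a-fold product ideal I_a(z_1^b⋯z_s^b)). Then for all positive integers k, ℓ, m one has the containment J_{ℓ(h+m−1)−h+k} ⊆ 𝔪^{((ℓ−1)(h−1)+k−1)·μ̂_h} · (J_m)^ℓ. -/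
open MvPolynomial

/-- The ideal `⟨X i : i ∈ S⟩ ^ n` consists of the polynomials whose monomials all have degree
at least `n` in the variables indexed by `S`. -/
lemma mem_span_X_image_pow_iff {σ R : Type*} [CommSemiring R] (S : Finset σ) (n : ℕ)
    (p : MvPolynomial σ R) :
    p ∈ (Ideal.span (X '' (S : Set σ)) : Ideal (MvPolynomial σ R)) ^ n ↔
      ∀ x ∈ p.support, n ≤ ∑ i ∈ S, x i := by
  classical
  constructor
  · have key : (Ideal.span (X '' (S : Set σ)) : Ideal (MvPolynomial σ R)) ^ n ≤
        Ideal.span ((fun x => monomial x (1 : R)) '' {x : σ →₀ ℕ | n ≤ ∑ i ∈ S, x i}) := by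
      induction n with
      | zero =>
        rw [pow_zero, Ideal.one_eq_top, top_le_iff, Ideal.eq_top_iff_one]
        exact Ideal.subset_span ⟨0, by simp, rfl⟩
      | succ n ih =>
        rw [pow_succ]
        refine (Ideal.mul_mono_left ih).trans ?_
        rw [Ideal.span_mul_span', Ideal.span_le]
        rintro _ ⟨_, ⟨x, hx, rfl⟩, _, ⟨i, hi, rfl⟩, rfl⟩
        refine Ideal.subset_span ⟨x + Finsupp.single i 1, ?_, ?_⟩
        · have : ∑ j ∈ S, Finsupp.single i 1 j = 1 := by
            simp [Finsupp.single_apply, Finset.mem_coe.1 hi]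
          simpa [Finset.sum_add_distrib, this] using hx
        · simp [X, monomial_mul]
    intro hp x hx
    obtain ⟨y, hy, hyx⟩ := mem_ideal_span_monomial_image.1 (key hp) x hx
    exact le_trans hy (Finset.sum_le_sum fun i _ => hyx i)
  · intro hp
    rw [p.as_sum]
    refine Ideal.sum_mem _ fun x hx => ?_
    have hprod : ∏ i ∈ S, (X i : MvPolynomial σ R) ^ x i ∈
        (Ideal.span (X '' (S : Set σ)) : Ideal (MvPolynomial σ R)) ^ ∑ i ∈ S, x i := by
      rw [← Finset.prod_pow_eq_pow_sum]
      exact Ideal.prod_mem_prod fun i hi =>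
        Ideal.pow_mem_pow (Ideal.subset_span (Set.mem_image_of_mem X hi)) _
    refine Ideal.mem_of_dvd _ ?_ (Ideal.pow_le_pow_right (hp x hx) hprod)
    rw [monomial_eq]
    refine Dvd.dvd.mul_left ?_ _
    rw [Finsupp.prod, ← Finset.prod_subset (Finset.inter_subset_left (s₁ := S) (s₂ := x.support))]
    · exact Finset.prod_dvd_prod_of_subset _ _ _ Finset.inter_subset_right
    · intro i hi hi'
      have : x i = 0 := by
        by_contra hne
        exact hi' (Finset.mem_inter.2 ⟨hi, Finsupp.mem_support_iff.2 hne⟩)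
      simp [this]

/-- The exponent vector `x` has degree at least `N * (b * |S| - h + 1)` in the variables
of every set `S` of at most `h` variables. -/
def IsSymbolicExponent {σ : Type*} (b h N : ℕ) (x : σ →₀ ℕ) : Prop :=
  ∀ S : Finset σ, S.card ≤ h → (N : ℤ) * (b * S.card - h + 1) ≤ ∑ i ∈ S, (x i : ℤ)

/-- Dividing an exponent vector by `l`, rounding down, keeps the conditions of order `m` when the
original vector satisfies those of order `l * m + D` with `D ≥ (l - 1) * (h - 1)`. -/
lemma IsSymbolicExponent.exists_nsmul_le {σ : Type*} {b h l m D : ℕ} {x : σ →₀ ℕ}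
    (hl : 0 < l) (hD : (l - 1) * (h - 1) ≤ D) (hx : IsSymbolicExponent b h (l * m + D) x) :
    ∃ q, IsSymbolicExponent b h m q ∧ l • q ≤ x := by
  refine ⟨x.mapRange (· / l) (Nat.zero_div l), fun S hS => ?_, fun i => ?_⟩
  · have h1 := hx S hS
    set μ : ℤ := b * S.card - h + 1
    have h2 : ∑ i ∈ S, (x i : ℤ) ≤
        l * ∑ i ∈ S, ((x i / l : ℕ) : ℤ) + S.card * (l - 1) := by
      rw [Finset.mul_sum, ← nsmul_eq_mul, ← Finset.sum_const, ← Finset.sum_add_distrib]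
      refine Finset.sum_le_sum fun i _ => ?_
      have e := Nat.div_add_mod (x i) l
      have e' := Nat.mod_lt (x i) hl
      zify at e e'
      push_cast
      linarith
    simp only [Finsupp.mapRange_apply]
    have h0 : (0 : ℤ) ≤ ∑ i ∈ S, ((x i / l : ℕ) : ℤ) := Finset.sum_nonneg fun _ _ => by positivity
    set Q := ∑ i ∈ S, ((x i / l : ℕ) : ℤ)
    rcases le_or_gt μ 0 with hμ | hμ
    · exact (mul_nonpos_of_nonneg_of_nonpos (by positivity) hμ).trans h0
    · have h3 : ((l : ℤ) - 1) * (S.card - 1) ≤ D * μ := by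
        have hl' : (0 : ℤ) ≤ (l : ℤ) - 1 := by
          have : (1 : ℤ) ≤ l := by exact_mod_cast hl
          linarith
        have hch : (S.card : ℤ) - 1 ≤ ((h - 1 : ℕ) : ℤ) := by omega
        have hD' : ((l : ℤ) - 1) * ((h - 1 : ℕ) : ℤ) ≤ D := by
          have : ((l - 1 : ℕ) : ℤ) = (l : ℤ) - 1 := by omega
          rw [← this]
          exact_mod_cast hD
        calc ((l : ℤ) - 1) * (S.card - 1) ≤ (l - 1) * ((h - 1 : ℕ) : ℤ) := by gcongr
          _ ≤ D := hD'
          _ ≤ D * μ := le_mul_of_one_le_right (by positivity) hμ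
      have h4 : (l : ℤ) * (m * μ) < l * (Q + 1) := by
        push_cast at h1
        nlinarith
      have := lt_of_mul_lt_mul_left h4 (by positivity)
      omega
  · simpa using Nat.mul_div_le (x i) l

/-- Every exponent vector satisfying the conditions dominates one that, in addition, is tight on
some set of `h` variables; any minimal one will do. -/
lemma IsSymbolicExponent.exists_le_tight {σ : Type*} [Fintype σ] {b h m : ℕ}
    (hb : 1 ≤ b) (hh : h ≤ Fintype.card σ) {q : σ →₀ ℕ} (hq : IsSymbolicExponent b h m q) :
    ∃ f ≤ q, IsSymbolicExponent b h m f ∧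
      ∃ H : Finset σ, H.card = h ∧ ∑ i ∈ H, (f i : ℤ) ≤ m * (b * h - h + 1) := by
  classical
  obtain ⟨f, hfq, hmin⟩ := exists_minimal_le_of_wellFoundedLT (IsSymbolicExponent b h m) q hq
  have hf := hmin.prop
  refine ⟨f, hfq, hf, ?_⟩
  by_contra! hlt
  obtain ⟨H, -, hH⟩ := Finset.exists_subset_card_eq (s := (Finset.univ : Finset σ)) (by simpa)
  have hpos := hlt H hH
  have hne : ∃ j, 0 < f j := by
    by_contra! h0
    have hs : ∑ i ∈ H, (f i : ℤ) = 0 := Finset.sum_eq_zero fun i _ => by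
      have := h0 i
      omega
    rw [hs] at hpos
    have hb' : (1 : ℤ) ≤ b := by exact_mod_cast hb
    have hbh : (0 : ℤ) ≤ b * h - h + 1 := by nlinarith
    exact hpos.not_ge (by positivity)
  obtain ⟨j, hj⟩ := hne
  have : Nonempty σ := ⟨j⟩
  obtain ⟨i, hi⟩ := Finite.exists_max f
  have hfi : 0 < f i := hj.trans_le (hi j)
  have hsub : ¬ IsSymbolicExponent b h m (f - Finsupp.single i 1) := fun hP => by
    have := hmin.le_of_le hP tsub_le_self i
    simp at this
    omega
  unfold IsSymbolicExponent at hsub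
  push Not at hsub
  obtain ⟨S, hS, hS'⟩ := hsub
  have hiS : i ∈ S := by
    by_contra hiS
    refine (hf S hS).not_gt (lt_of_eq_of_lt (Finset.sum_congr rfl fun t ht => ?_) hS')
    have : i ≠ t := fun h => hiS (h ▸ ht)
    simp [this]
  have hsum := Finset.add_sum_erase S (fun t => (f t : ℤ)) hiS
  have htight : ∑ t ∈ S, (f t : ℤ) ≤ m * (b * S.card - h + 1) := by
    have h1 := Finset.add_sum_erase S (fun t => ((f - Finsupp.single i 1 : σ →₀ ℕ) t : ℤ)) hiS
    have h2 : ∑ t ∈ S.erase i, ((f - Finsupp.single i 1 : σ →₀ ℕ) t : ℤ) =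
        ∑ t ∈ S.erase i, (f t : ℤ) := Finset.sum_congr rfl fun t ht => by
      simp [(Finset.ne_of_mem_erase ht).symm]
    have h3 : ((f - Finsupp.single i 1 : σ →₀ ℕ) i : ℤ) = f i - 1 := by
      simp
      omega
    simp only [h2, h3] at h1
    linarith
  obtain ⟨T, hST, hT⟩ := Finset.exists_superset_card_eq hS hh
  have hTlt := hlt T hT
  have hdiff : ∑ t ∈ T \ S, (f t : ℤ) ≤ (h - S.card) * f i := by
    have h1 : ∑ t ∈ T \ S, (f t : ℤ) ≤ (T \ S).card • (f i : ℤ) :=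
      Finset.sum_le_card_nsmul _ _ _ fun t _ => by exact_mod_cast hi t
    rwa [nsmul_eq_mul, Finset.card_sdiff_of_subset hST, hT, Nat.cast_sub hS] at h1
  have hsplit := Finset.sum_sdiff (f := fun t => (f t : ℤ)) hST
  have hbig : (m * b : ℤ) < f i := by
    have hc : (0 : ℤ) ≤ h - S.card := by
      have : (S.card : ℤ) ≤ h := by exact_mod_cast hS
      linarith
    refine lt_of_mul_lt_mul_left (a := (h - S.card : ℤ)) ?_ hc
    linarith
  have herase := hf (S.erase i) ((Finset.card_erase_le).trans hS)
  rw [Finset.cast_card_erase_of_mem hiS] at herase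
  linarith

/-- A monomial lies in `𝔪 ^ n * I ^ l` if it is divisible by the `l`-th power of a monomial of `I`,
with a quotient of degree at least `n`. -/
lemma monomial_mem_pow_mul_pow {σ R : Type*} [Fintype σ] [CommSemiring R]
    {I : Ideal (MvPolynomial σ R)} {x f : σ →₀ ℕ} {l n : ℕ} (c : R)
    (hfI : monomial f 1 ∈ I) (hfx : l • f ≤ x) (hn : n ≤ ∑ i, (x - l • f) i) :
    monomial x c ∈ Ideal.span (Set.range (X : σ → MvPolynomial σ R)) ^ n * I ^ l := by
  have hx : monomial x c = monomial (x - l • f) c * monomial f 1 ^ l := by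
    rw [monomial_pow, monomial_mul, one_pow, mul_one, tsub_add_cancel_of_le hfx]
  rw [hx]
  refine Ideal.mul_mem_mul ?_ (Ideal.pow_mem_pow hfI l)
  rw [← Set.image_univ, ← Finset.coe_univ, mem_span_X_image_pow_iff]
  intro y hy
  rw [Finset.mem_singleton.1 (support_monomial_subset hy)]
  exact hn

/-- In `T = K[z_1, …, z_s]`, with
`J_N = ⋂_{c=c₀}^{h} ⋂_{|S| = c} ⟨z_i : i ∈ S⟩^{N·μ̂_c}` (the `N`-th symbolic power of the
uniform `a`-fold product ideal `I_a(z₁ᵇ⋯z_sᵇ)`), one has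
`J_{ℓ(h+m-1)-h+k} ⊆ 𝔪^{((ℓ-1)(h-1)+k-1)·μ̂_h} · (J_m)^ℓ` for all positive `k, ℓ, m`. -/
theorem monomial_symbolic_containment {K : Type*} [Field K] (s a b : ℕ)
    (hs : 1 ≤ s) (hb : 2 ≤ b) (ha1 : (b - 1) * s + 1 < a) (ha2 : a < b * s)
    (h c₀ μ₀ : ℕ) (hh : h = b * s - a + 1) (hc₀ : c₀ = s - (a - 1) / b)
    (hμ₀ : μ₀ = a - b * (s - c₀))
    (J : ℕ → Ideal (MvPolynomial (Fin s) K))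
    (hJ : ∀ N : ℕ, J N =
      ⨅ (c : ℕ) (_ : c₀ ≤ c) (_ : c ≤ h) (S : Finset (Fin s)) (_ : S.card = c),
        (Ideal.span (X '' (S : Set (Fin s))) : Ideal (MvPolynomial (Fin s) K)) ^
          (N * (μ₀ + b * (c - c₀))))
    (k l m : ℕ) (hk : 0 < k) (hl : 0 < l) (hm : 0 < m) :
    J (l * (h + m - 1) - h + k) ≤
      (Ideal.span (Set.range (X : Fin s → MvPolynomial (Fin s) K))) ^
          (((l - 1) * (h - 1) + k - 1) * (μ₀ + b * (h - c₀))) *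
        (J m) ^ l := by
  set t := (a - 1) / b
  have ht1 : b * t ≤ a - 1 := Nat.mul_div_le _ _
  have ht2 : a - 1 < b * (t + 1) := Nat.lt_mul_div_succ _ (by omega)
  clear_value t
  have hts : t < s := lt_of_mul_lt_mul_left (ht1.trans_lt (by omega)) (Nat.zero_le b)
  have hbs : (b - 1) * s + s = b * s := by
    rw [← Nat.succ_mul]
    congr 1
    omega
  have hsc : s - c₀ = t := by omega
  rw [hsc] at hμ₀
  have hbc₀ : b * c₀ + b * t = b * s := by
    rw [← mul_add]
    congr 1
    omega
  have hμ : ∀ c, c₀ ≤ c → ((μ₀ + b * (c - c₀) : ℕ) : ℤ) = b * c - h + 1 := by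
    intro c hc
    obtain ⟨d, rfl⟩ := Nat.exists_eq_add_of_le hc
    have : μ₀ + h = b * c₀ + 1 := by omega
    zify at this
    rw [Nat.add_sub_cancel_left]
    push_cast
    linarith
  have hc₀h : c₀ ≤ h := by
    by_contra! hlt
    have h1 : b * (h + 1) ≤ b * c₀ := Nat.mul_le_mul_left b hlt
    have h2 : b * (t + 1) + b * c₀ = b * s + b := by
      rw [mul_add]
      omega
    have h3 : b * (h + 1) = b * h + b := by ring
    have h4 : 1 * h ≤ b * h := Nat.mul_le_mul_right h (by omega)
    omega
  have hmem : ∀ N p, p ∈ J N ↔ ∀ x ∈ p.support, IsSymbolicExponent b h N x := by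
    intro N p
    simp only [hJ, Submodule.mem_iInf, mem_span_X_image_pow_iff]
    constructor
    · intro hp x hx S hS
      rcases le_or_gt c₀ S.card with hc | hc
      · have := hp _ hc hS S rfl x hx
        zify at this
        rw [← hμ _ hc]
        exact_mod_cast this
      · have h1 : b * (S.card + 1) ≤ b * c₀ := Nat.mul_le_mul_left b hc
        have h2 : b * (t + 1) = b * t + b := by ring
        have h3 : b * (S.card + 1) = b * S.card + b := by ring
        have h4 : b * S.card + 1 ≤ h := by omega
        zify at h4
        exact (mul_nonpos_of_nonneg_of_nonpos (by positivity) (by linarith)).trans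
          (Finset.sum_nonneg fun _ _ => by positivity)
    · rintro hp c hc hch S rfl x hx
      have := hp x hx S hch
      rw [← hμ _ hc] at this
      exact_mod_cast this
  have hN : l * (h + m - 1) - h + k = l * m + ((l - 1) * (h - 1) + k - 1) := by
    obtain ⟨l, rfl⟩ := Nat.exists_eq_add_of_le' (show 1 ≤ l from hl)
    obtain ⟨g, hg⟩ := Nat.exists_eq_add_of_le' (show 1 ≤ h by omega)
    have h1 : (l + 1) * (h + m - 1) = (l + 1) * m + l * g + g := by
      rw [show h + m - 1 = m + g by omega]
      ring
    have h2 : (l + 1) * m = l * m + m := by ring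
    rw [h1, hg, Nat.add_sub_cancel, Nat.add_sub_cancel]
    omega
  set D := (l - 1) * (h - 1) + k - 1
  intro p hp
  rw [hN, hmem] at hp
  rw [p.as_sum]
  refine Ideal.sum_mem _ fun x hx => ?_
  obtain ⟨q, hq, hqx⟩ := (hp x hx).exists_nsmul_le hl (by omega)
  obtain ⟨f, hfq, hf, H, hH, hHf⟩ := hq.exists_le_tight (by omega)
    (by rw [Fintype.card_fin]; omega)
  have hfx : l • f ≤ x := (nsmul_le_nsmul_right hfq l).trans hqx
  refine monomial_mem_pow_mul_pow _ ?_ hfx ?_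
  · rw [hmem]
    intro y hy
    rwa [Finset.mem_singleton.1 (support_monomial_subset hy)]
  · refine le_trans ?_ (Finset.sum_le_sum_of_subset (Finset.subset_univ H))
    have h1 := hp x hx H hH.le
    have h2 : ∑ i ∈ H, (x - l • f) i + l * ∑ i ∈ H, f i = ∑ i ∈ H, x i := by
      rw [Finset.mul_sum, ← Finset.sum_add_distrib]
      refine Finset.sum_congr rfl fun i _ => ?_
      have := hfx i
      simp only [Finsupp.smul_apply, smul_eq_mul] at this
      simp [this]
    zify at h2 ⊢
    have h3 : (l : ℤ) * ∑ i ∈ H, (f i : ℤ) ≤ l * (m * (b * h - h + 1)) := by gcongr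
    have h4 := hμ h hc₀h
    push_cast at h4
    rw [hH] at h1
    push_cast [Nat.cast_sub hc₀h] at h1 h4 ⊢
    rw [h4]
    linarith
end

section
/- Let I = I_a(F^b) be the generalized star configuration ideal. Then for all positive integers k, ℓ, m, one has the containment I^{(ℓ(h+m−1)−h+k)} ⊆ 𝔪^{d·((ℓ−1)(h−1)+k−1)·(bh−(bs−a))} · (I^{(m)})^ℓ. -/
open MvPolynomial

/-- The `N`-th symbolic power of an ideal `I`:
`I^{(N)} = ⋂_{p ∈ Ass(R/I)} (I^N R_p ∩ R)`, where `I^N R_p ∩ R` is the preimage in `R` of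
the image of `I^N` under the localization map `R → R_p`. -/
noncomputable def symbolicPower {R : Type*} [CommRing R] (I : Ideal R) (N : ℕ) : Ideal R :=
  ⨅ (p : Ideal R) (hp : p ∈ associatedPrimes R (R ⧸ I)),
    haveI : p.IsPrime := hp.isPrime
    Ideal.comap (algebraMap R (Localization.AtPrime p))
      (Ideal.map (algebraMap R (Localization.AtPrime p)) (I ^ N))

/-- The generalized star configuration ideal (uniform `a`-fold product ideal)
`I_a(F^b) = ⟨f₁^{n₁} ⋯ f_s^{n_s} : 0 ≤ nᵢ ≤ b, ∑ nᵢ = a⟩`. -/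
noncomputable def afoldIdeal {R : Type*} [CommRing R] {s : ℕ} (f : Fin s → R) (a b : ℕ) :
    Ideal R :=
  Ideal.span {g | ∃ e : Fin s → ℕ, (∀ i, e i ≤ b) ∧ (∑ i, e i) = a ∧ g = ∏ i, f i ^ e i}

section PowerIdeals

variable {R : Type*} [CommRing R] {s : ℕ}

/-- The monomial `∏ i, f i ^ u i` in the elements of the family `f`. -/
noncomputable def famMonomial (f : Fin s → R) (u : Fin s → ℕ) : R := ∏ i, f i ^ u i

/-- The ideal generated by the monomials in `f` with exponent in `V`. -/
noncomputable def famMonomialIdeal (f : Fin s → R) (V : Set (Fin s → ℕ)) : Ideal R :=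
  Ideal.span (famMonomial f '' V)

/-- The ideal generated by the members of `f` indexed by `Z`. -/
noncomputable def famIdeal (f : Fin s → R) (Z : Finset (Fin s)) : Ideal R :=
  Ideal.span (f '' (Z : Set (Fin s)))

/-- The ideal generated by the powers `f j ^ (p j + 1)` with `j ∈ Z`. -/
noncomputable def famPowIdeal (f : Fin s → R) (p : Fin s → ℕ) (Z : Finset (Fin s)) : Ideal R :=
  Ideal.span ((fun j => f j ^ (p j + 1)) '' (Z : Set (Fin s)))

/-- Every member of `f` outside a set `Z` of at most `h` indices is a nonzerodivisor modulo the
ideal generated by the members indexed by `Z`. -/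
def IsGenericFamily (f : Fin s → R) (h : ℕ) : Prop :=
  ∀ Z : Finset (Fin s), Z.card ≤ h → ∀ k ∉ Z, ∀ g, f k * g ∈ famIdeal f Z → g ∈ famIdeal f Z

/-- `q` is the annihilator of an element of `R ⧸ J`. -/
def IsColonOf (q J : Ideal R) : Prop := ∃ g, ∀ c, c ∈ q ↔ c * g ∈ J

variable {f : Fin s → R} {h : ℕ}

lemma famMonomial_add (u v : Fin s → ℕ) :
    famMonomial f (u + v) = famMonomial f u * famMonomial f v := by
  simp [famMonomial, pow_add, Finset.prod_mul_distrib]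

lemma famMonomial_single (j : Fin s) : famMonomial f (Pi.single j 1) = f j := by
  rw [famMonomial, Finset.prod_eq_single j]
  · simp
  · intro i _ hi
    simp [Pi.single_eq_of_ne hi]
  · simp

lemma famMonomial_mem {V : Set (Fin s → ℕ)} {u : Fin s → ℕ} (hu : u ∈ V) :
    famMonomial f u ∈ famMonomialIdeal f V :=
  Ideal.subset_span ⟨u, hu, rfl⟩

lemma famMonomial_dvd {u v : Fin s → ℕ} (huv : u ≤ v) : famMonomial f u ∣ famMonomial f v :=
  Finset.prod_dvd_prod_of_dvd _ _ fun i _ => pow_dvd_pow _ (huv i)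

lemma famPowIdeal_congr {p p' : Fin s → ℕ} {Z : Finset (Fin s)} (hp : ∀ j ∈ Z, p j = p' j) :
    famPowIdeal f p Z = famPowIdeal f p' Z := by
  unfold famPowIdeal
  congr 1
  exact Set.image_congr fun j hj => by rw [hp j hj]

lemma famPowIdeal_zero {p : Fin s → ℕ} {Z : Finset (Fin s)} (hp : ∀ j ∈ Z, p j = 0) :
    famPowIdeal f p Z = famIdeal f Z := by
  unfold famPowIdeal famIdeal
  congr 1
  exact Set.image_congr fun j hj => by simp [hp j hj]

lemma famPowIdeal_erase (p : Fin s → ℕ) {Z : Finset (Fin s)} {i : Fin s} (hi : i ∈ Z) :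
    famPowIdeal f p Z = Ideal.span {f i ^ (p i + 1)} ⊔ famPowIdeal f p (Z.erase i) := by
  unfold famPowIdeal
  conv_lhs => rw [← Finset.insert_erase hi, Finset.coe_insert, Set.image_insert_eq]
  rw [Ideal.span_insert]

lemma IsGenericFamily.mem_famPowIdeal_of_mul_mem (H : IsGenericFamily f h)
    {Z : Finset (Fin s)} (hZ : Z.card ≤ h) (p : Fin s → ℕ) {k : Fin s} (hk : k ∉ Z) {g : R}
    (hg : f k * g ∈ famPowIdeal f p Z) : g ∈ famPowIdeal f p Z := by
  obtain ⟨n, hn⟩ : ∃ n, ∑ j ∈ Z, (p j + 1) = n := ⟨_, rfl⟩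
  induction n using Nat.strong_induction_on generalizing Z p k g with
  | _ n ih =>
  by_cases h0 : ∀ j ∈ Z, p j = 0
  · rw [famPowIdeal_zero h0] at hg ⊢
    exact H Z hZ k hk g hg
  push Not at h0
  obtain ⟨i, hi, hpi⟩ := h0
  obtain ⟨e, he⟩ := Nat.exists_eq_add_one_of_ne_zero hpi
  have key : ∀ c : ℕ, famPowIdeal f (Function.update p i c) Z =
      Ideal.span {f i ^ (c + 1)} ⊔ famPowIdeal f p (Z.erase i) := by
    intro c
    rw [famPowIdeal_erase _ hi, Function.update_self]
    congr 1
    exact famPowIdeal_congr fun j hj => Function.update_of_ne (Finset.ne_of_mem_erase hj) _ _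
  have hsum : ∀ q : Fin s → ℕ, ∑ j ∈ Z, (q j + 1) =
      (q i + 1) + ∑ j ∈ Z.erase i, (q j + 1) := fun q =>
    (Finset.add_sum_erase Z (fun j => q j + 1) hi).symm
  have hupd : ∀ c : ℕ, c < p i → ∑ j ∈ Z, (Function.update p i c j + 1) < n := by
    intro c hc
    rw [← hn, hsum, hsum p, Function.update_self]
    have : ∑ j ∈ Z.erase i, (Function.update p i c j + 1) = ∑ j ∈ Z.erase i, (p j + 1) :=
      Finset.sum_congr rfl fun j hj => by
        rw [Function.update_of_ne (Finset.ne_of_mem_erase hj)]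
    omega
  have hZe : (Z.erase i).card ≤ h := (Finset.card_erase_le).trans hZ
  have hsumE : ∑ j ∈ Z.erase i, (p j + 1) < n := by
    rw [← hn, hsum p]; omega
  rw [famPowIdeal_erase p hi, Ideal.mem_span_singleton_sup] at hg ⊢
  obtain ⟨a, b, hb, hab⟩ := hg
  have h1 : g ∈ famPowIdeal f (Function.update p i e) Z := by
    refine ih _ (hupd e (by omega)) hZ _ hk ?_ rfl
    rw [key, Ideal.mem_span_singleton_sup]
    refine ⟨a * f i, b, hb, ?_⟩
    rw [← hab, he]; ring
  rw [key, Ideal.mem_span_singleton_sup] at h1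
  obtain ⟨r, t, ht, hrt⟩ := h1
  have hpow : ∀ (m : ℕ) (y : R), f i ^ m * y ∈ famPowIdeal f p (Z.erase i) →
      y ∈ famPowIdeal f p (Z.erase i) := by
    intro m
    induction m with
    | zero => intro y hy; simpa using hy
    | succ m ihm =>
      intro y hy
      refine ihm y (ih _ hsumE hZe p (Finset.notMem_erase i Z) (g := f i ^ m * y) ?_ rfl)
      rw [← mul_assoc, ← pow_succ']
      exact hy
  have h2 : f k * r - a * f i ∈ famPowIdeal f p (Z.erase i) := by
    refine hpow (e + 1) _ ?_
    have : f i ^ (e + 1) * (f k * r - a * f i) = b - f k * t := by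
      rw [← hrt, he] at hab
      linear_combination -hab
    rw [this]
    exact sub_mem hb (Ideal.mul_mem_left _ _ ht)
  have h3 : r ∈ famPowIdeal f (Function.update p i 0) Z := by
    refine ih _ (hupd 0 (by omega)) hZ _ hk ?_ rfl
    rw [key, Ideal.mem_span_singleton_sup]
    exact ⟨a, _, h2, by ring⟩
  rw [key, Ideal.mem_span_singleton_sup] at h3
  obtain ⟨a', t', ht', h3⟩ := h3
  refine ⟨a', f i ^ (e + 1) * t' + t, add_mem (Ideal.mul_mem_left _ _ ht') ht, ?_⟩
  rw [← hrt, ← h3, he]; ring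

lemma IsGenericFamily.mem_famPowIdeal_of_pow_mul_mem (H : IsGenericFamily f h)
    {Z : Finset (Fin s)} (hZ : Z.card ≤ h) (p : Fin s → ℕ) {k : Fin s} (hk : k ∉ Z) (m : ℕ)
    {g : R} (hg : f k ^ m * g ∈ famPowIdeal f p Z) : g ∈ famPowIdeal f p Z := by
  induction m with
  | zero => simpa using hg
  | succ m ih =>
    refine ih (H.mem_famPowIdeal_of_mul_mem hZ p hk (g := f k ^ m * g) ?_)
    rwa [← mul_assoc, ← pow_succ']

/-- Modulo the ideal of the powers `f j ^ (v j + 1)`, `j ∈ S`, the annihilator of the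
monomial with exponent `v` is contained in the ideal of the `f j`, `j ∈ S`. -/
lemma IsGenericFamily.mem_famIdeal_of_famMonomial_mul_mem (H : IsGenericFamily f h)
    {S : Finset (Fin s)} (hS : S.card ≤ h) (v : Fin s → ℕ) {g : R}
    (hg : famMonomial f v * g ∈ famPowIdeal f v S) : g ∈ famIdeal f S := by
  have outer : ∀ A : Finset (Fin s), Disjoint A S → ∀ y,
      (∏ j ∈ A, f j ^ v j) * y ∈ famPowIdeal f v S → y ∈ famPowIdeal f v S := by
    intro A
    induction A using Finset.induction_on with
    | empty => intro _ y hy; simpa using hy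
    | insert i A hiA ih =>
      intro hd y hy
      rw [Finset.disjoint_insert_left] at hd
      refine ih hd.2 y (H.mem_famPowIdeal_of_pow_mul_mem hS v hd.1 (v i) ?_)
      rwa [← mul_assoc, ← Finset.prod_insert (f := fun j => f j ^ v j) hiA]
  have inner : ∀ A : Finset (Fin s), A ⊆ S → ∀ y,
      (∏ j ∈ A, f j ^ v j) * y ∈ famPowIdeal f (fun j => if j ∈ A then v j else 0) S →
        y ∈ famIdeal f S := by
    intro A
    induction A using Finset.induction_on with
    | empty =>
      intro _ y hy
      rw [famPowIdeal_zero (by simp)] at hy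
      simpa using hy
    | insert i A hiA ih =>
      intro hAS y hy
      have hi : i ∈ S := hAS (Finset.mem_insert_self _ _)
      refine ih ((Finset.subset_insert _ _).trans hAS) y ?_
      have hcong : famPowIdeal f (fun j => if j ∈ insert i A then v j else 0) (S.erase i) =
          famPowIdeal f (fun j => if j ∈ A then v j else 0) (S.erase i) :=
        famPowIdeal_congr fun j hj => by simp [Finset.ne_of_mem_erase hj]
      rw [famPowIdeal_erase _ hi, hcong, Finset.prod_insert hiA,
        Ideal.mem_span_singleton_sup] at hy
      obtain ⟨a, b, hb, hab⟩ := hy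
      simp only [Finset.mem_insert_self, if_true] at hab
      have : (∏ j ∈ A, f j ^ v j) * y - a * f i ∈
          famPowIdeal f (fun j => if j ∈ A then v j else 0) (S.erase i) := by
        refine H.mem_famPowIdeal_of_pow_mul_mem (Finset.card_erase_le.trans hS) _
          (Finset.notMem_erase i S) (v i) ?_
        have : f i ^ v i * ((∏ j ∈ A, f j ^ v j) * y - a * f i) = b := by
          linear_combination -hab
        rwa [this]
      rw [famPowIdeal_erase _ hi, Ideal.mem_span_singleton_sup]
      exact ⟨a, _, this, by simp [hiA]⟩
  refine inner S subset_rfl g ?_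
  rw [famPowIdeal_congr (p' := v) (by simp +contextual)]
  refine outer Sᶜ disjoint_compl_left _ ?_
  rwa [← mul_assoc, mul_comm (∏ j ∈ Sᶜ, _), Finset.prod_mul_prod_compl]

/-- If `q` is a prime annihilator in `R ⧸ J` and the annihilator of `x` in `R ⧸ J` is `P`, then `q`
is an annihilator in `R ⧸ P` or in `R ⧸ (J + (x))`. -/
lemma IsColonOf.of_sup_span {q J J' P : Ideal R} (hq : q.IsPrime) {x : R} (hJJ' : J ≤ J')
    (hJ' : J' ≤ J ⊔ Ideal.span {x}) (hP : ∀ c, c * x ∈ J ↔ c ∈ P) (hqJ : IsColonOf q J) :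
    IsColonOf q P ∨ IsColonOf q J' := by
  obtain ⟨g, hg⟩ := hqJ
  by_cases hc : ∃ c ∉ q, c * g ∈ J'
  · left
    obtain ⟨c, hcq, hcg⟩ := hc
    have := hJ' hcg
    rw [sup_comm, Ideal.mem_span_singleton_sup] at this
    obtain ⟨r, t, ht, hrt⟩ := this
    refine ⟨r, fun y => ?_⟩
    rw [← hP]
    have : y * r * x = y * c * g - y * t := by linear_combination y * hrt
    rw [this, Submodule.sub_mem_iff_left _ (Ideal.mul_mem_left _ _ ht), ← hg]
    exact ⟨fun hy => Ideal.mul_mem_right _ _ hy, fun hy => (hq.mem_or_mem hy).resolve_right hcq⟩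
  · right
    push Not at hc
    refine ⟨g, fun c => ⟨fun hcq => hJJ' ((hg c).1 hcq), fun hcg => ?_⟩⟩
    by_contra hcq
    exact hc c hcq hcg

lemma mem_associatedPrimes_quotient_iff [IsNoetherianRing R] {q J : Ideal R} :
    q ∈ associatedPrimes R (R ⧸ J) ↔ q.IsPrime ∧ IsColonOf q J := by
  rw [AssociatedPrimes.mem_iff, isAssociatedPrime_iff]
  refine and_congr_right fun _ => ?_
  have key : ∀ g c : R, c • (Ideal.Quotient.mk J g) = 0 ↔ c * g ∈ J := by
    intro g c
    rw [← Ideal.Quotient.eq_zero_iff_mem, map_mul]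
    rfl
  constructor
  · rintro ⟨x, hx⟩
    obtain ⟨g, rfl⟩ := Ideal.Quotient.mk_surjective x
    refine ⟨g, fun c => ?_⟩
    rw [hx, Submodule.mem_colon_singleton, Submodule.mem_bot, key]
  · rintro ⟨g, hg⟩
    refine ⟨Ideal.Quotient.mk J g, ?_⟩
    ext c
    rw [hg, Submodule.mem_colon_singleton, Submodule.mem_bot, key]

lemma exists_isColonOf_of_notMem [IsNoetherianRing R] {J : Ideal R} {g : R} (hg : g ∉ J) :
    ∃ q : Ideal R, q.IsPrime ∧ IsColonOf q J ∧ ∀ c, c * g ∈ J → c ∈ q := by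
  obtain ⟨q, hq, hle⟩ := exists_le_isAssociatedPrime_of_isNoetherianRing R
    (Ideal.Quotient.mk J g) (fun h0 => hg (Ideal.Quotient.eq_zero_iff_mem.1 h0))
  obtain ⟨h1, h2⟩ := mem_associatedPrimes_quotient_iff.1 hq
  refine ⟨q, h1, h2, fun c hc => hle ?_⟩
  rw [Submodule.mem_colon_singleton, Submodule.mem_bot]
  rw [← Ideal.Quotient.eq_zero_iff_mem, map_mul] at hc
  exact hc

lemma mem_symbolicPower_iff [IsNoetherianRing R] {I : Ideal R} {N : ℕ} {g : R} :
    g ∈ symbolicPower I N ↔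
      ∀ q : Ideal R, q.IsPrime → IsColonOf q I → ∃ c ∉ q, c * g ∈ I ^ N := by
  simp only [symbolicPower, Submodule.mem_iInf, Ideal.mem_comap]
  have key : ∀ (q : Ideal R) [q.IsPrime], algebraMap R (Localization.AtPrime q) g ∈
      Ideal.map (algebraMap R (Localization.AtPrime q)) (I ^ N) ↔ ∃ c ∉ q, c * g ∈ I ^ N := by
    intro q _
    rw [IsLocalization.algebraMap_mem_map_algebraMap_iff q.primeCompl]
    rfl
  constructor
  · intro H q hq hqI
    exact (key q).1 (H q (mem_associatedPrimes_quotient_iff.2 ⟨hq, hqI⟩))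
  · intro H q hqI
    obtain ⟨hq, hc⟩ := mem_associatedPrimes_quotient_iff.1 hqI
    exact (key q).2 (H q hq hc)

end PowerIdeals

section Filtration

variable {s : ℕ}

/-- Exponent vectors `u` with `B * #T ≤ ∑_{j ∈ T} u j + D` for all `T` of size at most `h`. -/
def boundedDeficit (s B D h : ℕ) : Set (Fin s → ℕ) :=
  {u | ∀ T : Finset (Fin s), T.card ≤ h → B * T.card ≤ ∑ j ∈ T, u j + D}

/-- The set `S` witnesses that `v` is not in `boundedDeficit s B D h`. -/
def IsViolating (B D h : ℕ) (v : Fin s → ℕ) (S : Finset (Fin s)) : Prop :=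
  S.card ≤ h ∧ ∑ j ∈ S, v j + D < B * S.card

/-- The sum of `v` over `S`, refined to take distinct values on distinct sets `S`. -/
def refinedSum (v : Fin s → ℕ) (S : Finset (Fin s)) : ℕ :=
  ∑ j ∈ S, (2 ^ s * v j + 2 ^ (j : ℕ))

/-- `S` has the least refined sum among the sets witnessing `v ∉ boundedDeficit s B D h`. -/
def IsMinViolating (B D h : ℕ) (v : Fin s → ℕ) (S : Finset (Fin s)) : Prop :=
  IsViolating B D h v S ∧ ∀ S', IsViolating B D h v S' → refinedSum v S ≤ refinedSum v S'

variable {B D h : ℕ}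

lemma refinedSum_mod (v : Fin s → ℕ) (S : Finset (Fin s)) :
    refinedSum v S % 2 ^ s = ∑ j ∈ S, 2 ^ (j : ℕ) := by
  have hlt : ∑ j ∈ S, 2 ^ (j : ℕ) < 2 ^ s := by
    have := Nat.geomSum_lt (m := 2) (n := s) (s := S.map Fin.valEmbedding) le_rfl (by simp)
    simpa using this
  rw [refinedSum, Finset.sum_add_distrib, ← Finset.mul_sum, Nat.mul_add_mod,
    Nat.mod_eq_of_lt hlt]

lemma eq_of_refinedSum_eq {u v : Fin s → ℕ} {S T : Finset (Fin s)}
    (hST : refinedSum u S = refinedSum v T) : S = T := by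
  have h1 := congrArg (· % 2 ^ s) hST
  simp only [refinedSum_mod] at h1
  have h2 := Finset.geomSum_injective (n := 2) le_rfl
    (a₁ := S.map Fin.valEmbedding) (a₂ := T.map Fin.valEmbedding) (by simpa using h1)
  exact Finset.map_injective _ h2

lemma refinedSum_le {u v : Fin s → ℕ} {S : Finset (Fin s)} (huv : ∀ j ∈ S, u j ≤ v j) :
    refinedSum u S ≤ refinedSum v S :=
  Finset.sum_le_sum fun j hj => by gcongr; exact huv j hj

lemma eq_of_refinedSum_le {u v : Fin s → ℕ} {S : Finset (Fin s)} (huv : ∀ j ∈ S, u j ≤ v j)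
    (hle : refinedSum v S ≤ refinedSum u S) : ∀ j ∈ S, u j = v j := by
  by_contra! hne
  obtain ⟨j, hj, hjne⟩ := hne
  refine absurd hle (not_le.2 (Finset.sum_lt_sum (fun j hj => ?_) ⟨j, hj, ?_⟩))
  · gcongr; exact huv j hj
  · have := lt_of_le_of_ne (huv j hj) hjne
    gcongr

lemma IsViolating.mono {u v : Fin s → ℕ} {S : Finset (Fin s)} (huv : ∀ j ∈ S, u j ≤ v j)
    (hv : IsViolating B D h v S) : IsViolating B D h u S :=
  ⟨hv.1, lt_of_le_of_lt (by gcongr with j hj; exact huv j hj) hv.2⟩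

lemma IsViolating.exists_isMinViolating {v : Fin s → ℕ} {S : Finset (Fin s)}
    (hS : IsViolating B D h v S) : ∃ T, IsMinViolating B D h v T := by
  obtain ⟨T, hT, hmin⟩ := Set.exists_min_image {T | IsViolating B D h v T} (refinedSum v)
    (Set.toFinite _) ⟨S, hS⟩
  exact ⟨T, hT, hmin⟩

lemma IsMinViolating.weight_lt {v : Fin s → ℕ} {S : Finset (Fin s)}
    (hS : IsMinViolating B D h v S) {i j : Fin s} (hj : j ∈ S) (hi : i ∉ S) :
    2 ^ s * v j + 2 ^ (j : ℕ) < 2 ^ s * v i + 2 ^ (i : ℕ) := by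
  by_contra! hle
  have hie : i ∉ S.erase j := fun hh => hi (Finset.mem_of_mem_erase hh)
  have hvij : v i ≤ v j := by
    have h1 : 2 ^ (j : ℕ) < 2 ^ s := Nat.pow_lt_pow_right (by norm_num) j.2
    have h2 : 2 ^ s * v i < 2 ^ s * (v j + 1) := by
      rw [mul_add, mul_one]
      linarith [Nat.zero_le (2 ^ (i : ℕ))]
    exact Nat.lt_succ_iff.1 (lt_of_mul_lt_mul_left h2 (Nat.zero_le _))
  have hcard : (insert i (S.erase j)).card = S.card := by
    rw [Finset.card_insert_of_notMem hie, Finset.card_erase_add_one hj]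
  have hsum : ∑ x ∈ insert i (S.erase j), v x ≤ ∑ x ∈ S, v x := by
    rw [Finset.sum_insert hie, ← Finset.add_sum_erase S v hj]
    omega
  have hviol : IsViolating B D h v (insert i (S.erase j)) :=
    ⟨hcard ▸ hS.1.1, by rw [hcard]; have := hS.1.2; omega⟩
  have hle' : refinedSum v (insert i (S.erase j)) ≤ refinedSum v S := by
    rw [refinedSum, refinedSum, Finset.sum_insert hie,
      ← Finset.add_sum_erase S (fun j : Fin s => 2 ^ s * v j + 2 ^ (j : ℕ)) hj]
    omega
  have heq := eq_of_refinedSum_eq (le_antisymm (hS.2 _ hviol) hle')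
  exact hi (heq ▸ Finset.mem_insert_self _ _)

lemma IsMinViolating.inf {u v : Fin s → ℕ} {S : Finset (Fin s)}
    (hu : IsMinViolating B D h u S) (hv : IsMinViolating B D h v S)
    (huv : ∀ j ∈ S, u j = v j) : IsMinViolating B D h (u ⊓ v) S := by
  have hxv : ∀ j ∈ S, (u ⊓ v) j = v j := fun j hj => by simp [huv j hj]
  have hviol : IsViolating B D h (u ⊓ v) S := hv.1.mono fun j hj => (hxv j hj).le
  obtain ⟨T, hT⟩ := hviol.exists_isMinViolating
  suffices T = S from this ▸ hT
  by_cases hTS : T ⊆ S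
  · have hTv : ∀ j ∈ T, (u ⊓ v) j = v j := fun j hj => hxv j (hTS hj)
    have h1 : refinedSum v S ≤ refinedSum v T :=
      hv.2 T (hT.1.mono fun j hj => (hTv j hj).ge)
    have h2 : refinedSum v T ≤ refinedSum v S :=
      Finset.sum_le_sum_of_subset hTS
    exact eq_of_refinedSum_eq (le_antisymm h2 h1)
  · obtain ⟨i, hiT, hiS⟩ := Finset.not_subset.1 hTS
    by_cases hST : S ⊆ T
    · have h1 := hT.2 S hviol
      have h2 : refinedSum (u ⊓ v) S ≤ refinedSum (u ⊓ v) T := Finset.sum_le_sum_of_subset hST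
      exact eq_of_refinedSum_eq (le_antisymm h1 h2)
    · obtain ⟨j, hjS, hjT⟩ := Finset.not_subset.1 hST
      have h1 := hT.weight_lt hiT hjT
      have h2 := hu.weight_lt hjS hiS
      have h3 := hv.weight_lt hjS hiS
      rw [hxv j hjS] at h1
      rw [huv j hjS] at h2
      rcases le_total (u i) (v i) with hle | hle
      · simp only [Pi.inf_apply, inf_of_le_left hle] at h1
        omega
      · simp only [Pi.inf_apply, inf_of_le_right hle] at h1
        omega

variable {R : Type*} [CommRing R] {f : Fin s → R}

/-- The exponent vectors that do not lie in one of the cells indexed by `X`, a cell being the set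
of all `u` with a given minimal violating set `S` and given values on `S`. -/
def outsideCells (B D h : ℕ) (X : Finset (Finset (Fin s) × (Fin s → ℕ))) : Set (Fin s → ℕ) :=
  {u | ∀ S, IsMinViolating B D h u S → (S, S.piecewise u 0) ∉ X}

lemma refinedSum_piecewise (u : Fin s → ℕ) (S : Finset (Fin s)) :
    refinedSum (S.piecewise u 0) S = refinedSum u S :=
  Finset.sum_congr rfl fun j hj => by simp [hj]

lemma IsGenericFamily.exists_isColonOf_famIdeal_of_cells (H : IsGenericFamily f h)
    {q : Ideal R} (hq : q.IsPrime) (X : Finset (Finset (Fin s) × (Fin s → ℕ)))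
    (hX : ∀ u S, IsMinViolating B D h u S →
      (∃ a ∈ X, refinedSum u S < refinedSum a.2 a.1) → (S, S.piecewise u 0) ∈ X)
    (hqX : IsColonOf q (famMonomialIdeal f (outsideCells B D h X))) :
    ∃ S : Finset (Fin s), S.card ≤ h ∧ D < B * S.card ∧ IsColonOf q (famIdeal f S) := by
  classical
  induction X using Finset.induction_on_max_value
    (fun a : Finset (Fin s) × (Fin s → ℕ) => refinedSum a.2 a.1) with
  | empty =>
    exfalso
    obtain ⟨g, hg⟩ := hqX
    have h1 : (1 : R) ∈ famMonomialIdeal f (outsideCells B D h (s := s) ∅) := by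
      have := famMonomial_mem (f := f) (V := outsideCells B D h (s := s) ∅) (u := 0)
        (by simp [outsideCells])
      simpa [famMonomial] using this
    rw [(Ideal.eq_top_iff_one _).2 h1] at hg
    exact hq.ne_top ((Ideal.eq_top_iff_one _).2 ((hg 1).2 trivial))
  | insert a X haX hmax ih =>
    have hX' : ∀ u S, IsMinViolating B D h u S →
        (∃ a ∈ X, refinedSum u S < refinedSum a.2 a.1) → (S, S.piecewise u 0) ∈ X := by
      rintro u S hu ⟨p, hp, hlt⟩
      refine (Finset.mem_insert.1 (hX u S hu ⟨p, Finset.mem_insert_of_mem hp, hlt⟩)).resolve_left ?_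
      rintro rfl
      have := hmax p hp
      rw [refinedSum_piecewise] at this
      exact absurd hlt (not_lt.2 this)
    by_cases hcell : ∃ v, IsMinViolating B D h v a.1 ∧ a.1.piecewise v 0 = a.2
    swap
    · refine ih hX' ?_
      convert hqX using 2
      ext u
      refine ⟨fun hu S hS hmem => ?_, fun hu S hS hmem => hu S hS (Finset.mem_insert_of_mem hmem)⟩
      rcases Finset.mem_insert.1 hmem with rfl | hmem
      · exact hcell ⟨u, hS, rfl⟩
      · exact hu S hS hmem
    obtain ⟨S, y⟩ := a
    obtain ⟨v, ⟨hv, hvy⟩, hvmin⟩ := exists_minimal_of_wellFoundedLT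
      (fun v => IsMinViolating B D h v S ∧ S.piecewise v 0 = y) hcell
    dsimp only at hvmin hmax
    subst hvy
    rw [refinedSum_piecewise] at hmax
    have hleast : ∀ u, IsMinViolating B D h u S → S.piecewise u 0 = S.piecewise v 0 → v ≤ u := by
      intro u hu huv
      have huv' : ∀ j ∈ S, u j = v j := fun j hj => by
        have := congrFun huv j
        simpa [hj] using this
      refine (hvmin ⟨hu.inf hv huv', ?_⟩ inf_le_right).trans inf_le_left
      ext j
      by_cases hj : j ∈ S
      · simp [hj, huv' j hj]
      · simp [hj]
    set J := famMonomialIdeal f (outsideCells B D h (insert (S, S.piecewise v 0) X)) with hJ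
    have hcolon : ∀ c, c * famMonomial f v ∈ J ↔ c ∈ famIdeal f S := by
      intro c
      constructor
      · intro hc
        have hle : J ≤ famPowIdeal f v S := by
          rw [hJ, famMonomialIdeal, Ideal.span_le]
          rintro _ ⟨u, hu, rfl⟩
          obtain ⟨j, hj, hju⟩ : ∃ j ∈ S, v j < u j := by
            by_contra! hle
            obtain ⟨T, hT⟩ := (hv.1.mono hle).exists_isMinViolating
            have h1 : refinedSum u T ≤ refinedSum u S := hT.2 S (hv.1.mono hle)
            have h2 := refinedSum_le hle
            refine hu T hT ?_
            rcases (h1.trans h2).lt_or_eq with hlt | heq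
            · refine hX u T hT ⟨_, Finset.mem_insert_self _ _, ?_⟩
              rwa [refinedSum_piecewise]
            · obtain rfl := eq_of_refinedSum_eq heq
              have h3 := eq_of_refinedSum_le hle heq.ge
              convert Finset.mem_insert_self _ _ using 2
              ext j
              by_cases hj : j ∈ T
              · simp [hj, h3 j hj]
              · simp [hj]
          have h1 : f j ^ (v j + 1) ∈ famPowIdeal f v S := Ideal.subset_span ⟨j, hj, rfl⟩
          exact Ideal.mem_of_dvd _ ((pow_dvd_pow _ hju).trans
            (Finset.dvd_prod_of_mem (fun i => f i ^ u i) (Finset.mem_univ j))) h1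
        refine H.mem_famIdeal_of_famMonomial_mul_mem hv.1.1 v (hle ?_)
        rwa [mul_comm]
      · intro hc
        have hle : famIdeal f S ≤ Submodule.colon J {famMonomial f v} := by
          rw [famIdeal, Ideal.span_le]
          rintro _ ⟨j, hj, rfl⟩
          rw [SetLike.mem_coe, Submodule.mem_colon_singleton, smul_eq_mul,
            ← famMonomial_single (f := f) j, ← famMonomial_add]
          refine famMonomial_mem fun T hT hmem => ?_
          have hvle : ∀ i, v i ≤ (Pi.single j 1 + v : Fin s → ℕ) i := fun i => by simp
          have h1 : refinedSum v S ≤ refinedSum v T := hv.2 T (hT.1.mono fun i _ => hvle i)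
          have h2 : refinedSum v T ≤ refinedSum (Pi.single j 1 + v) T :=
            refinedSum_le fun i _ => hvle i
          have h3 : refinedSum (Pi.single j 1 + v) T ≤ refinedSum v S := by
            rcases Finset.mem_insert.1 hmem with heq | hmem
            · rw [← refinedSum_piecewise, ← refinedSum_piecewise v S]
              simp only [Prod.mk.injEq] at heq
              rw [heq.2, heq.1]
            · have := hmax _ hmem
              rwa [refinedSum_piecewise] at this
          obtain rfl := eq_of_refinedSum_eq (le_antisymm (h2.trans h3) h1)
          have := eq_of_refinedSum_le (fun i _ => hvle i) h3 j hj
          simp at this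
        simpa using Submodule.mem_colon_singleton.1 (hle hc)
    have hsub : outsideCells B D h (insert (S, S.piecewise v 0) X) ⊆ outsideCells B D h X :=
      fun u hu T hT hmem => hu T hT (Finset.mem_insert_of_mem hmem)
    have hsup : famMonomialIdeal f (outsideCells B D h X) ≤ J ⊔ Ideal.span {famMonomial f v} := by
      rw [famMonomialIdeal, Ideal.span_le]
      rintro _ ⟨u, hu, rfl⟩
      by_cases hu' : u ∈ outsideCells B D h (insert (S, S.piecewise v 0) X)
      · exact Ideal.mem_sup_left (famMonomial_mem hu')
      · simp only [outsideCells, Set.mem_ofPred_eq, not_forall, not_not] at hu'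
        obtain ⟨T, hT, hmem⟩ := hu'
        have heq := (Finset.mem_insert.1 hmem).resolve_right (hu T hT)
        simp only [Prod.mk.injEq] at heq
        obtain ⟨rfl, heq⟩ := heq
        exact Ideal.mem_sup_right (Ideal.mem_span_singleton.2 (famMonomial_dvd (hleast u hT heq)))
    rcases hqX.of_sup_span hq (Ideal.span_mono (Set.image_mono hsub)) hsup hcolon with hS | hJ'
    · exact ⟨S, hv.1.1, by have := hv.1.2; omega, hS⟩
    · exact ih hX' hJ'

/-- The associated primes of the monomial ideal with exponents in `boundedDeficit s B D h` are
associated to ideals generated by at most `h` members of the family. -/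
lemma IsGenericFamily.exists_isColonOf_famIdeal (H : IsGenericFamily f h)
    {q : Ideal R} (hq : q.IsPrime)
    (hqJ : IsColonOf q (famMonomialIdeal f (boundedDeficit s B D h))) :
    ∃ S : Finset (Fin s), S.card ≤ h ∧ D < B * S.card ∧ IsColonOf q (famIdeal f S) := by
  classical
  have hmem : ∀ (u : Fin s → ℕ) S, IsMinViolating B D h u S → (S, S.piecewise u 0) ∈
      (Finset.univ : Finset (Finset (Fin s))) ×ˢ
        Fintype.piFinset fun _ : Fin s => Finset.range (B * s + 1) := by
    intro u S hS
    simp only [Finset.mem_product, Finset.mem_univ, true_and, Fintype.mem_piFinset,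
      Finset.mem_range]
    intro j
    by_cases hj : j ∈ S
    · have h1 : u j ≤ ∑ i ∈ S, u i := Finset.single_le_sum (fun _ _ => Nat.zero_le _) hj
      have h2 := hS.1.2
      have h3 : B * S.card ≤ B * s := Nat.mul_le_mul_left _ (card_finset_fin_le S)
      simp only [hj, Finset.piecewise_eq_of_mem]
      omega
    · simp [hj]
  refine H.exists_isColonOf_famIdeal_of_cells hq _ (fun u S hS _ => hmem u S hS) ?_
  convert hqJ using 2
  ext u
  constructor
  · intro hu T hT
    by_contra! hlt
    obtain ⟨S, hS⟩ := IsViolating.exists_isMinViolating (B := B) (D := D) ⟨hT, hlt⟩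
    exact hu S hS (hmem u S hS)
  · intro hu S hS
    exact absurd (hu S hS.1.1) (not_le.2 hS.1.2)

end Filtration

section StarConfig

variable {R : Type*} [CommRing R] {s : ℕ} {f : Fin s → R} {h : ℕ}

lemma isGenericFamily_of_isWeaklyRegular
    (hgen : ∀ l : List (Fin s), l.Nodup → l.length ≤ h + 1 →
      RingTheory.Sequence.IsWeaklyRegular R (l.map f)) : IsGenericFamily f h := by
  intro Z hZ k hk g hg
  have hreg := (hgen (Z.toList ++ [k])
    (List.nodup_append.2 ⟨Z.nodup_toList, List.nodup_singleton k, by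
      rintro a ha _ hb rfl
      rw [List.mem_singleton] at hb
      exact hk (by simpa [hb] using ha)⟩)
    (by simpa using hZ)).regular_mod_prev Z.card (by simp)
  have hlen : (Z.toList.map f).length = Z.card := by simp
  have htake : ((Z.toList ++ [k]).map f).take Z.card = Z.toList.map f := by
    rw [List.map_append, List.take_left' hlen]
  rw [htake] at hreg
  simp only [List.map_append, List.map_singleton, ← hlen, List.getElem_concat_length] at hreg
  have hideal : (Ideal.ofList (Z.toList.map f) • ⊤ : Ideal R) = famIdeal f Z := by
    rw [smul_eq_mul, Ideal.mul_top, famIdeal, Ideal.ofList]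
    congr 1
    ext x
    simp
  rw [hideal] at hreg
  exact (isSMulRegular_quotient_iff_mem_of_smul_mem _ _).1 hreg g hg

lemma exists_le_sum_eq {ι : Type*} (Z : Finset ι) (u : ι → ℕ) {n : ℕ} (hn : n ≤ ∑ i ∈ Z, u i) :
    ∃ v : ι → ℕ, v ≤ u ∧ ∑ i ∈ Z, v i = n := by
  classical
  induction Z using Finset.induction_on generalizing n with
  | empty => exact ⟨0, fun _ => Nat.zero_le _, by
      rw [Finset.sum_empty] at hn ⊢
      omega⟩
  | insert j Z hj ih =>
    rw [Finset.sum_insert hj] at hn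
    obtain ⟨v, hv, hsum⟩ := ih (n := n - min n (u j)) (by omega)
    refine ⟨Function.update v j (min n (u j)), fun i => ?_, ?_⟩
    · rcases eq_or_ne i j with rfl | hij
      · simp
      · simpa [hij] using hv i
    · rw [Finset.sum_insert hj, Finset.sum_update_of_notMem hj, hsum]
      simp

lemma exists_balanced_div {ι : Type*} (Z : Finset ι) (u : ι → ℕ) (m : ℕ) :
    ∃ v : ι → ℕ, (∀ i ∈ Z, u i / (m + 1) ≤ v i ∧ v i ≤ (u i + m) / (m + 1)) ∧
      ∑ i ∈ Z, v i = (∑ i ∈ Z, u i) / (m + 1) := by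
  classical
  induction Z using Finset.induction_on with
  | empty => exact ⟨0, by simp⟩
  | insert j Z hj ih =>
    obtain ⟨v, hv, hsum⟩ := ih
    set D := ∑ i ∈ Z, u i
    have h0 : D / (m + 1) + u j / (m + 1) ≤ (u j + D) / (m + 1) := by
      rw [add_comm]; exact Nat.div_add_div_le_add_div
    have h1 : (u j + D) / (m + 1) ≤ D / (m + 1) + (u j + m) / (m + 1) := by
      refine Nat.lt_succ_iff.1 ((Nat.div_lt_iff_lt_mul (Nat.succ_pos m)).2 ?_)
      have h2 := Nat.lt_mul_div_succ D (Nat.succ_pos m)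
      have h3 := Nat.lt_mul_div_succ (u j + m) (Nat.succ_pos m)
      simp only [Nat.succ_eq_add_one] at *
      nlinarith
    refine ⟨Function.update v j ((u j + D) / (m + 1) - D / (m + 1)), fun i hi => ?_, ?_⟩
    · rcases eq_or_ne i j with rfl | hij
      · rw [Function.update_self]
        exact ⟨le_tsub_of_add_le_left h0, tsub_le_iff_left.2 h1⟩
      · simpa [hij] using hv i ((Finset.mem_insert.1 hi).resolve_left hij)
    · rw [Finset.sum_insert hj, Finset.sum_update_of_notMem hj, Finset.sum_insert hj, hsum,
        Function.update_self]
      exact Nat.sub_add_cancel ((Nat.le_add_right _ _).trans h0)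

lemma le_add_div_succ {x m b : ℕ} (hx : x ≤ (m + 1) * b) : x ≤ x / (m + 1) + m * b := by
  have h1 := Nat.lt_mul_div_succ x (Nat.succ_pos m)
  simp only [Nat.succ_eq_add_one] at h1
  rcases lt_or_ge (x / (m + 1)) b with hlt | hge
  · nlinarith
  · nlinarith

variable {a b : ℕ}

lemma famMonomial_mem_afoldIdeal {v : Fin s → ℕ} (hvb : ∀ i, v i ≤ b) (hsum : a ≤ ∑ i, v i) :
    famMonomial f v ∈ afoldIdeal f a b := by
  obtain ⟨e, hev, he⟩ := exists_le_sum_eq Finset.univ v hsum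
  exact Ideal.mem_of_dvd _ (famMonomial_dvd hev)
    (Ideal.subset_span ⟨e, fun i => (hev i).trans (hvb i), he, rfl⟩)

lemma famMonomial_mem_afoldIdeal_pow (hab : a ≤ b * s) (m : ℕ) {v : Fin s → ℕ}
    (hv : ∑ i, (m * b - v i) ≤ m * (b * s - a)) :
    famMonomial f v ∈ afoldIdeal f a b ^ m := by
  induction m generalizing v with
  | zero => simp
  | succ m ih =>
    obtain ⟨ε, hε, hsum⟩ := exists_balanced_div Finset.univ (fun i => (m + 1) * b - v i) m
    have hlow : ∀ i, (m + 1) * b - v i ≤ ε i + m * b := fun i =>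
      (le_add_div_succ (Nat.sub_le _ _)).trans
        (Nat.add_le_add_right (hε i (Finset.mem_univ i)).1 _)
    have hεb : ∀ i, ε i ≤ b := fun i => by
      refine (hε i (Finset.mem_univ i)).2.trans ?_
      refine Nat.lt_succ_iff.1 ((Nat.div_lt_iff_lt_mul (Nat.succ_pos m)).2 ?_)
      have : (m + 1) * b - v i ≤ (m + 1) * b := Nat.sub_le _ _
      simp only [Nat.succ_eq_add_one]
      nlinarith
    have hεle : ∀ i, ε i ≤ (m + 1) * b - v i := fun i => by
      refine (hε i (Finset.mem_univ i)).2.trans ?_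
      refine Nat.lt_succ_iff.1 ((Nat.div_lt_iff_lt_mul (Nat.succ_pos m)).2 ?_)
      simp only [Nat.succ_eq_add_one]
      nlinarith [Nat.zero_le (((m + 1) * b - v i) * m)]
    have hεsum : ∑ i, ε i ≤ b * s - a := by
      rw [hsum]
      exact Nat.div_le_of_le_mul hv
    have hev : (fun i => b - ε i) ≤ v := fun i => by
      have := hlow i
      have := add_mul m 1 b
      simp only
      omega
    have hdef : ∀ i, m * b - (v i - (b - ε i)) + ε i = (m + 1) * b - v i := fun i => by
      have h1 := hlow i
      have h2 := add_mul m 1 b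
      have h3 := hεb i
      have h4 := hεle i
      have h5 := hev i
      simp only at h5
      omega
    rw [← tsub_add_cancel_of_le hev, famMonomial_add, pow_succ]
    refine Ideal.mul_mem_mul (ih ?_) (famMonomial_mem_afoldIdeal (fun i => Nat.sub_le _ _) ?_)
    · have h1 : ∑ i, (m * b - (v i - (b - ε i))) + ∑ i, ε i = ∑ i, ((m + 1) * b - v i) := by
        rw [← Finset.sum_add_distrib]
        exact Finset.sum_congr rfl fun i _ => hdef i
      have h2 := le_add_div_succ hv
      simp only [Pi.sub_apply]
      omega
    · have h1 : ∑ i, (b - ε i) + ∑ i, ε i = b * s := by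
        rw [← Finset.sum_add_distrib, Finset.sum_congr rfl fun i _ => Nat.sub_add_cancel (hεb i)]
        simp [mul_comm]
      omega

lemma sum_tsub_le_of_subset {B D : ℕ} {v : Fin s → ℕ} {S : Finset (Fin s)}
    (hvS : ∀ j ∉ S, B ≤ v j)
    (hv : ∀ T ⊆ S, B * T.card ≤ ∑ j ∈ T, v j + D) : ∑ i, (B - v i) ≤ D := by
  classical
  set T := Finset.univ.filter fun j => v j < B with hT
  have hTS : T ⊆ S := fun j hj => by
    by_contra hjS
    exact absurd (hvS j hjS) (not_le.2 (Finset.mem_filter.1 hj).2)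
  have h1 : ∑ i ∈ T, (B - v i) = ∑ i, (B - v i) :=
    Finset.sum_subset (Finset.subset_univ T) fun i _ hi => by
      have : ¬ v i < B := fun hlt => hi (Finset.mem_filter.2 ⟨Finset.mem_univ i, hlt⟩)
      omega
  have h2 : ∑ i ∈ T, (B - v i) + ∑ i ∈ T, v i = B * T.card := by
    rw [← Finset.sum_add_distrib,
      Finset.sum_congr rfl fun i hi => Nat.sub_add_cancel (Finset.mem_filter.1 hi).2.le]
    simp [mul_comm]
  have h3 := hv T hTS
  omega

/-- The exponents `u` for which the monomial with exponent `u` lies in the `N`-th symbolic power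
of the star configuration ideal. -/
def starExponents (s a b h N : ℕ) : Set (Fin s → ℕ) :=
  boundedDeficit s (N * b) (N * (b * s - a)) h

lemma famMonomialIdeal_starExponents_one_le (hh : h = b * s - a + 1) (hab : a ≤ b * s) :
    famMonomialIdeal f (starExponents s a b h 1) ≤ afoldIdeal f a b := by
  classical
  rw [famMonomialIdeal, Ideal.span_le]
  rintro _ ⟨u, hu, rfl⟩
  simp only [starExponents, boundedDeficit, one_mul, Set.mem_ofPred_eq] at hu
  set T := Finset.univ.filter fun j => u j < b with hT
  have hcard : T.card ≤ h := by
    by_contra! hlt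
    obtain ⟨T', hT', hcard⟩ := Finset.exists_subset_card_eq hlt.le
    have h1 := hu T' hcard.le
    have h2 : ∑ j ∈ T', (u j + 1) ≤ ∑ _j ∈ T', b :=
      Finset.sum_le_sum fun j hj => (Finset.mem_filter.1 (hT' hj)).2
    rw [Finset.sum_add_distrib] at h2
    simp only [Finset.sum_const, smul_eq_mul, mul_one, hcard] at h1 h2
    rw [mul_comm] at h2
    omega
  have h1 := famMonomial_mem_afoldIdeal_pow (f := f) hab 1 (v := u) (by
    simpa using sum_tsub_le_of_subset (B := b)
      (fun j hj => not_lt.1 fun hlt => hj (Finset.mem_filter.2 ⟨Finset.mem_univ j, hlt⟩))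
      fun T' hT' => hu T' ((Finset.card_le_card hT').trans hcard))
  simpa using h1

lemma afoldIdeal_le_famMonomialIdeal (hab : a ≤ b * s) :
    afoldIdeal f a b ≤ famMonomialIdeal f (starExponents s a b h 1) := by
  classical
  rw [afoldIdeal, Ideal.span_le]
  rintro _ ⟨e, heb, hsum, rfl⟩
  refine famMonomial_mem fun T _ => ?_
  have h1 := Finset.sum_add_sum_compl T e
  have h2 : ∑ j ∈ Tᶜ, e j ≤ b * (s - T.card) := by
    refine (Finset.sum_le_card_nsmul _ _ b fun j _ => heb j).trans ?_
    rw [Finset.card_compl, Fintype.card_fin, smul_eq_mul, mul_comm]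
  have h3 : b * (s - T.card) + b * T.card = b * s := by
    rw [← mul_add, Nat.sub_add_cancel (card_finset_fin_le T)]
  simp only [one_mul]
  omega

lemma afoldIdeal_eq_famMonomialIdeal (hh : h = b * s - a + 1) (hab : a ≤ b * s) :
    afoldIdeal f a b = famMonomialIdeal f (starExponents s a b h 1) :=
  le_antisymm (afoldIdeal_le_famMonomialIdeal hab)
    (famMonomialIdeal_starExponents_one_le hh hab)

lemma afoldIdeal_pow_le_famMonomialIdeal (hab : a ≤ b * s) (N : ℕ) :
    afoldIdeal f a b ^ N ≤ famMonomialIdeal f (starExponents s a b h N) := by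
  induction N with
  | zero =>
    have h1 : (1 : R) ∈ famMonomialIdeal f (starExponents s a b h 0) := by
      have := famMonomial_mem (f := f) (V := starExponents s a b h 0) (u := 0)
        (by simp [starExponents, boundedDeficit])
      simpa [famMonomial] using this
    rw [(Ideal.eq_top_iff_one _).2 h1]
    exact le_top
  | succ N ih =>
    rw [pow_succ]
    refine (Ideal.mul_mono ih (afoldIdeal_le_famMonomialIdeal (h := h) hab)).trans ?_
    rw [famMonomialIdeal, famMonomialIdeal, Ideal.span_mul_span', Ideal.span_le]
    rintro _ ⟨_, ⟨u, hu, rfl⟩, _, ⟨v, hv, rfl⟩, rfl⟩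
    simp only [← famMonomial_add]
    refine famMonomial_mem fun T hT => ?_
    have h1 := hu T hT
    have h2 := hv T hT
    simp only [Pi.add_apply, Finset.sum_add_distrib]
    nlinarith

/-- A prime associated to an ideal generated by a large enough subfamily is associated to the
star configuration ideal. -/
lemma IsGenericFamily.isColonOf_afoldIdeal (H : IsGenericFamily f h) (hh : h = b * s - a + 1)
    (hab : a ≤ b * s) {S : Finset (Fin s)} (hS : S.card ≤ h) (hbS : b * s - a < b * S.card)
    {q : Ideal R} (hq : IsColonOf q (famIdeal f S)) : IsColonOf q (afoldIdeal f a b) := by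
  classical
  have hb : 0 < b := by
    rcases Nat.eq_zero_or_pos b with rfl | hb
    · simp at hbS
    · exact hb
  obtain ⟨w, hw, hwsum⟩ := exists_le_sum_eq S (fun _ => b - 1) (n := b * S.card - h) (by
    have h1 : (b - 1) * S.card + S.card = b * S.card := by
      rw [← Nat.succ_mul, Nat.succ_eq_add_one, Nat.sub_add_cancel hb]
    simp only [Finset.sum_const, smul_eq_mul]
    rw [mul_comm S.card]
    omega)
  set v : Fin s → ℕ := S.piecewise w fun _ => b with hv
  have hvS : ∑ j ∈ S, v j = b * S.card - h := by
    rw [← hwsum]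
    exact Finset.sum_congr rfl fun j hj => by simp [hv, hj]
  have hvC : ∑ j ∈ Sᶜ, v j + b * S.card = b * s := by
    rw [Finset.sum_congr rfl (g := fun _ => b) fun j hj => by
      simp [hv, Finset.mem_compl.1 hj]]
    rw [Finset.sum_const, smul_eq_mul, mul_comm, ← mul_add, Finset.card_compl, Fintype.card_fin,
      Nat.sub_add_cancel (card_finset_fin_le S)]
  have hvsum : ∑ j, v j + 1 = a := by
    rw [← Finset.sum_add_sum_compl S v]
    omega
  have hvb : ∀ j, v j ≤ b := fun j => by
    by_cases hj : j ∈ S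
    · simpa [hv, hj] using (hw j).trans (Nat.sub_le b 1)
    · simp [hv, hj]
  obtain ⟨g, hg⟩ := hq
  refine ⟨g * famMonomial f v, fun c => (hg c).trans ⟨fun hc => ?_, fun hc => ?_⟩⟩
  · have hle : famIdeal f S ≤ Submodule.colon (afoldIdeal f a b) {famMonomial f v} := by
      rw [famIdeal, Ideal.span_le]
      rintro _ ⟨j, hj, rfl⟩
      rw [SetLike.mem_coe, Submodule.mem_colon_singleton, smul_eq_mul,
        ← famMonomial_single (f := f) j, ← famMonomial_add]
      refine famMonomial_mem_afoldIdeal (fun i => ?_) ?_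
      · rcases eq_or_ne i j with rfl | hij
        · have := hw i
          simp only [Pi.add_apply, Pi.single_eq_same, hv, Finset.piecewise_eq_of_mem _ _ _ hj]
          simp only at this
          omega
        · simpa [hij] using hvb i
      · simp only [Pi.add_apply, Finset.sum_add_distrib, Finset.sum_pi_single', Finset.mem_univ,
          if_true]
        omega
    rw [← mul_assoc]
    simpa using Submodule.mem_colon_singleton.1 (hle hc)
  · refine H.mem_famIdeal_of_famMonomial_mul_mem hS v ?_
    have hle : afoldIdeal f a b ≤ famPowIdeal f v S := by
      rw [afoldIdeal, Ideal.span_le]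
      rintro _ ⟨e, heb, hesum, rfl⟩
      obtain ⟨j, hj, hje⟩ : ∃ j ∈ S, v j < e j := by
        by_contra! hle
        have : ∑ j, e j ≤ ∑ j, v j := Finset.sum_le_sum fun j _ => by
          by_cases hj : j ∈ S
          · exact hle j hj
          · simpa [hv, hj] using heb j
        omega
      have h1 : f j ^ (v j + 1) ∈ famPowIdeal f v S := Ideal.subset_span ⟨j, hj, rfl⟩
      exact Ideal.mem_of_dvd _ ((pow_dvd_pow _ hje).trans
        (Finset.dvd_prod_of_mem (fun i => f i ^ e i) (Finset.mem_univ j))) h1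
    rw [mul_comm, mul_assoc]
    exact hle hc

lemma IsGenericFamily.symbolicPower_le [IsNoetherianRing R] (H : IsGenericFamily f h)
    (hh : h = b * s - a + 1) (hab : a ≤ b * s) {N : ℕ} :
    symbolicPower (afoldIdeal f a b) N ≤ famMonomialIdeal f (starExponents s a b h N) := by
  intro g hg
  by_contra hgJ
  obtain ⟨q, hq, hqJ, hle⟩ := exists_isColonOf_of_notMem hgJ
  obtain ⟨S, hS, hSlt, hqS⟩ := H.exists_isColonOf_famIdeal hq hqJ
  rw [mul_assoc] at hSlt
  have hqI := H.isColonOf_afoldIdeal hh hab hS (lt_of_mul_lt_mul_left hSlt (Nat.zero_le N)) hqS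
  obtain ⟨c, hcq, hc⟩ := mem_symbolicPower_iff.1 hg q hq hqI
  exact hcq (hle c (afoldIdeal_pow_le_famMonomialIdeal hab N hc))

lemma IsGenericFamily.le_symbolicPower [IsNoetherianRing R] (H : IsGenericFamily f h)
    (hh : h = b * s - a + 1) (hab : a ≤ b * s) {m : ℕ} :
    famMonomialIdeal f (starExponents s a b h m) ≤ symbolicPower (afoldIdeal f a b) m := by
  classical
  rw [famMonomialIdeal, Ideal.span_le]
  rintro _ ⟨u, hu, rfl⟩
  refine mem_symbolicPower_iff.2 fun q hq hqI => ?_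
  rw [afoldIdeal_eq_famMonomialIdeal hh hab] at hqI
  obtain ⟨S, hS, -, g, hg⟩ := H.exists_isColonOf_famIdeal hq hqI
  have hfq : ∀ j ∉ S, f j ∉ q := fun j hj hjq => by
    have h1 := H S hS j hj g ((hg _).1 hjq)
    exact hq.ne_top ((Ideal.eq_top_iff_one _).2 ((hg 1).2 (by simpa using h1)))
  refine ⟨famMonomial f (S.piecewise 0 fun _ => m * b), fun hmem => ?_, ?_⟩
  · obtain ⟨j, -, hj⟩ := (Ideal.IsPrime.prod_mem_iff (hp := hq)).1 hmem
    by_cases hjS : j ∈ S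
    · simp only [hjS, Finset.piecewise_eq_of_mem, Pi.zero_apply, pow_zero] at hj
      exact hq.ne_top ((Ideal.eq_top_iff_one _).2 hj)
    · exact hfq j hjS (hq.mem_of_pow_mem _ hj)
  · rw [← famMonomial_add]
    refine famMonomial_mem_afoldIdeal_pow hab m ?_
    refine sum_tsub_le_of_subset (S := S) (fun j hj => ?_) fun T hT => ?_
    · simp [hj]
    · refine (hu T ((Finset.card_le_card hT).trans hS)).trans ?_
      gcongr with j hj
      simp

lemma exists_le_mem_boundedDeficit {c m : ℕ} (hh : 0 < h) (hhs : h ≤ s) (hcb : c ≤ b * h)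
    {x : Fin s → ℕ} (hx : x ∈ boundedDeficit s (m * b) (m * c) h) :
    ∃ y ≤ x, y ∈ boundedDeficit s (m * b) (m * c) h ∧
      ∃ Z : Finset (Fin s), Z.card = h ∧ ∑ j ∈ Z, y j + m * c ≤ m * b * h := by
  classical
  obtain ⟨y, ⟨hyx, hy⟩, hymin⟩ := exists_minimal_of_wellFoundedLT
    (fun y => y ≤ x ∧ y ∈ boundedDeficit s (m * b) (m * c) h) ⟨x, le_rfl, hx⟩
  refine ⟨y, hyx, hy, ?_⟩
  by_contra! hlt
  have : Nonempty (Fin s) := ⟨⟨0, hh.trans_le hhs⟩⟩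
  obtain ⟨i, hi⟩ := Finite.exists_max y
  have hpos : 0 < y i := by
    by_contra! h0
    obtain ⟨Z, -, hZ⟩ := Finset.exists_subset_card_eq (s := (Finset.univ : Finset (Fin s)))
      (n := h) (by simpa using hhs)
    have h1 := hlt Z hZ
    have h2 : ∑ j ∈ Z, y j = 0 := Finset.sum_eq_zero fun j _ => by
      have := hi j
      omega
    have h3 : m * c ≤ m * (b * h) := Nat.mul_le_mul_left _ hcb
    rw [h2, mul_assoc] at h1
    omega
  have hle : Function.update y i (y i - 1) ≤ y := by
    exact update_le_self_iff.2 (Nat.sub_le _ _)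
  have hnot : Function.update y i (y i - 1) ∉ boundedDeficit s (m * b) (m * c) h := fun hmem => by
    have h1 : y i ≤ Function.update y i (y i - 1) i := hymin ⟨hle.trans hyx, hmem⟩ hle i
    rw [Function.update_self] at h1
    omega
  simp only [boundedDeficit, Set.mem_ofPred_eq, not_forall, not_le] at hnot
  obtain ⟨T, hT, hTlt⟩ := hnot
  have hiT : i ∈ T := by
    by_contra hiT
    rw [Finset.sum_update_of_notMem hiT] at hTlt
    exact absurd (hy T hT) (not_le.2 hTlt)
  have herase := Finset.add_sum_erase T y hiT
  rw [Finset.sum_update_of_mem hiT, Finset.sdiff_singleton_eq_erase] at hTlt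
  have hyi : y i ≤ m * b := by
    have h1 := hy (T.erase i) ((Finset.card_le_card (Finset.erase_subset _ _)).trans hT)
    have h2 : m * b * T.card = m * b * (T.erase i).card + m * b := by
      rw [← Finset.card_erase_add_one hiT, mul_add, mul_one]
    omega
  obtain ⟨Z, hTZ, hZ⟩ := Finset.exists_superset_card_eq hT (by simpa using hhs)
  have h1 := hlt Z hZ
  have h2 : ∑ j ∈ Z \ T, y j ≤ (Z \ T).card * (m * b) :=
    Finset.sum_le_card_nsmul _ _ _ fun j _ => (hi j).trans hyi
  have h3 := Finset.sum_sdiff (f := y) hTZ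
  have h4 : (Z \ T).card * (m * b) + m * b * T.card = m * b * h := by
    rw [mul_comm, ← mul_add, Finset.card_sdiff_add_card_eq_card hTZ, hZ]
  omega

lemma div_mem_boundedDeficit {c m l r : ℕ} (hh : h = c + 1) {u : Fin s → ℕ}
    (hu : u ∈ boundedDeficit s (((l + 1) * m + l * c + r) * b)
      (((l + 1) * m + l * c + r) * c) h) :
    (fun j => u j / (l + 1)) ∈ boundedDeficit s (m * b) (m * c) h := by
  intro T hT
  have h1 := hu T hT
  set N := (l + 1) * m + l * c + r
  have h2 : ∑ j ∈ T, u j ≤ (l + 1) * ∑ j ∈ T, u j / (l + 1) + l * T.card := by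
    rw [Finset.mul_sum, mul_comm l, ← smul_eq_mul T.card, ← Finset.sum_const,
      ← Finset.sum_add_distrib]
    refine Finset.sum_le_sum fun j _ => ?_
    have := Nat.lt_mul_div_succ (u j) (Nat.succ_pos l)
    simp only [Nat.succ_eq_add_one, mul_add, mul_one] at this
    omega
  set Y := ∑ j ∈ T, u j / (l + 1)
  rcases le_or_gt (b * T.card) c with hle | hgt
  · rw [mul_assoc]
    exact (Nat.mul_le_mul_left m hle).trans (Nat.le_add_left _ _)
  · obtain ⟨z, hz⟩ := Nat.exists_eq_add_of_lt hgt
    rw [mul_assoc, hz] at h1 ⊢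
    have h3 : N * (z + 1) ≤ (l + 1) * Y + l * (c + 1) := by
      have := Nat.mul_le_mul_left l (hT.trans hh.le)
      nlinarith
    have h4 : ((l + 1) * m + l * c) * (z + 1) ≤ N * (z + 1) :=
      Nat.mul_le_mul_right _ (Nat.le_add_right _ _)
    have h5 : (l + 1) * (m * (z + 1)) < (l + 1) * (Y + 1) := by
      nlinarith [Nat.zero_le (l * c * z)]
    have h6 := lt_of_mul_lt_mul_left h5 (Nat.zero_le _)
    nlinarith

/-- Every exponent of the `N`-th level contains `l + 1` copies of an exponent of the `m`-th level,
with a remainder of large total degree. -/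
lemma exists_le_mem_starExponents {m l r : ℕ} (hh : h = b * s - a + 1) (hhs : h ≤ s)
    (hb : 0 < b) {u : Fin s → ℕ}
    (hu : u ∈ starExponents s a b h ((l + 1) * m + l * (b * s - a) + r)) :
    ∃ y ∈ starExponents s a b h m, (l + 1) • y ≤ u ∧
      (l * (h - 1) + r) * (b * h - (b * s - a)) ≤ ∑ j, (u - (l + 1) • y) j := by
  set c := b * s - a with hc
  have hcb : c < b * h := by nlinarith
  obtain ⟨y, hyx, hy, Z, hZ, hZsum⟩ := exists_le_mem_boundedDeficit (b := b) (hh ▸ c.succ_pos)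
    hhs hcb.le (div_mem_boundedDeficit hh hu)
  have hyu : (l + 1) • y ≤ u := fun j => by
    have := Nat.mul_le_mul_left (l + 1) (hyx j)
    exact this.trans (Nat.mul_div_le _ _)
  refine ⟨y, hy, hyu, ?_⟩
  have h1 := hu Z hZ.le
  rw [hZ] at h1
  have h2 : ∑ j ∈ Z, (u - (l + 1) • y) j + (l + 1) * ∑ j ∈ Z, y j = ∑ j ∈ Z, u j := by
    rw [Finset.mul_sum, ← Finset.sum_add_distrib]
    exact Finset.sum_congr rfl fun j _ => Nat.sub_add_cancel (hyu j)
  refine le_trans ?_ (Finset.sum_le_sum_of_subset (Finset.subset_univ Z))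
  obtain ⟨z, hz⟩ := Nat.exists_eq_add_of_lt hcb
  have hz' : b * h - c = z + 1 := by omega
  have hh' : h - 1 = c := by omega
  rw [hz', hh']
  rw [mul_assoc, hz] at h1 hZsum
  nlinarith

lemma famMonomial_mem_pow {J : Ideal R} {d : ℕ} (hJ : ∀ j, f j ∈ J ^ d) (u : Fin s → ℕ) :
    famMonomial f u ∈ J ^ (d * ∑ j, u j) := by
  rw [Finset.mul_sum, ← Finset.prod_pow_eq_pow_sum]
  refine Ideal.prod_mem_prod fun j _ => ?_
  rw [pow_mul]
  exact Ideal.pow_mem_pow (hJ j) _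

lemma famMonomial_nsmul (l : ℕ) (u : Fin s → ℕ) : famMonomial f (l • u) = famMonomial f u ^ l := by
  simp [famMonomial, Finset.prod_pow, mul_comm l, pow_mul]

end StarConfig

/-- For the generalized star configuration ideal `I = I_a(F^b)` of an
`h`-generic set of `s` forms of degree `d` (with `(b-1)s + 1 < a ≤ bs`, `h = bs - a + 1 ≤ n`),
one has `I^{(ℓ(h+m-1)-h+k)} ⊆ 𝔪^{d((ℓ-1)(h-1)+k-1)(bh-(bs-a))} (I^{(m)})^ℓ` for all
positive integers `k, ℓ, m`. -/
theorem genStarConfig_containment {K : Type*} [Field K] [Infinite K]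
    (n s a b d : ℕ) (hs : 0 < s) (ha : 0 < a) (hb0 : 0 < b) (hd : 0 < d)
    (ha1 : (b - 1) * s + 1 < a) (ha2 : a ≤ b * s)
    (h : ℕ) (hh : h = b * s - a + 1) (hn : h ≤ n)
    (f : Fin s → MvPolynomial (Fin (n + 1)) K)
    (hinj : Function.Injective f) (hne : ∀ i, f i ≠ 0)
    (hhom : ∀ i, (f i).IsHomogeneous d)
    (hgen : ∀ l : List (Fin s), l.Nodup → l.length ≤ h + 1 →
      RingTheory.Sequence.IsRegular (MvPolynomial (Fin (n + 1)) K) (l.map f))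
    (k l m : ℕ) (hk : 0 < k) (hl : 0 < l) (hm : 0 < m) :
    symbolicPower (afoldIdeal f a b) (l * (h + m - 1) - h + k) ≤
      (Ideal.span (Set.range (X : Fin (n + 1) → MvPolynomial (Fin (n + 1)) K))) ^
          (d * ((l - 1) * (h - 1) + k - 1) * (b * h - (b * s - a))) *
        (symbolicPower (afoldIdeal f a b) m) ^ l := by
  have H : IsGenericFamily f h := isGenericFamily_of_isWeaklyRegular fun L hL hlen =>
    (hgen L hL hlen).toIsWeaklyRegular
  obtain ⟨l, rfl⟩ := Nat.exists_eq_succ_of_ne_zero hl.ne'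
  obtain ⟨m, rfl⟩ := Nat.exists_eq_succ_of_ne_zero hm.ne'
  obtain ⟨k, rfl⟩ := Nat.exists_eq_succ_of_ne_zero hk.ne'
  simp only [Nat.succ_eq_add_one, Nat.add_sub_cancel]
  have hN : (l + 1) * (h + (m + 1) - 1) - h + (k + 1) =
      (l + 1) * (m + 1) + l * (b * s - a) + k := by
    have h1 : (l + 1) * (h + (m + 1) - 1) =
        h + ((l + 1) * (m + 1) + l * (b * s - a) - 1) := by
      zify [show 1 ≤ h + (m + 1) by omega,
        show 1 ≤ (l + 1) * (m + 1) + l * (b * s - a) by nlinarith]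
      rw [hh]
      push_cast
      ring
    have h2 : 0 < (l + 1) * (m + 1) := by positivity
    rw [h1]
    omega
  have hhs : h ≤ s := by
    have : (b - 1) * s + s = b * s := by
      rw [← Nat.succ_mul, Nat.succ_eq_add_one, Nat.sub_add_cancel hb0]
    omega
  rw [hN]
  refine (H.symbolicPower_le hh ha2).trans ?_
  rw [famMonomialIdeal, Ideal.span_le]
  rintro _ ⟨u, hu, rfl⟩
  obtain ⟨y, hy, hyu, hdeg⟩ := exists_le_mem_starExponents hh hhs hb0 hu
  rw [← tsub_add_cancel_of_le hyu, famMonomial_add, famMonomial_nsmul]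
  refine Ideal.mul_mem_mul (Ideal.pow_le_pow_right ?_ (famMonomial_mem_pow (d := d)
    (fun j => ?_) _)) (Ideal.pow_mem_pow (H.le_symbolicPower hh ha2 (famMonomial_mem hy)) _)
  · rw [mul_assoc]
    exact Nat.mul_le_mul_left d hdeg
  · refine (mem_pow_idealOfVars_iff' _ _).2 fun x hx => ?_
    exact (hhom j).coeff_eq_zero (by omega)
end
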